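/- Let 𝒢 be the class of all connected regular graphs of odd degree which do not have a 1-factor, and let Π be the graph problem defined by: for G=(V,E)∈𝒢, Π(G) consists of all non-constant functions S:V→{0,1} (i.e., there exist u,v∈V with S(u)≠S(v)); for G∉𝒢, Π(G) consists of all functions S:V→{0,1}. Then Π∈VVc(1) but Π∉VV. -/

import Mathlib

namespace Weak

/-- The degree of a vertex. -/
noncomputable def deg {n : ℕ} (G : SimpleGraph (Fin n)) (v : Fin n) : ℕ :=
  Nat.card {u : Fin n // G.Adj v u}

/-- A port of a graph: a pair (v, i) with i ∈ [deg v]. -/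
abbrev Port {n : ℕ} (G : SimpleGraph (Fin n)) : Type := Σ v : Fin n, Fin (deg G v)

/-- A port numbering: a bijection on ports with A(p) = A(G). -/
structure PortNumbering {n : ℕ} (G : SimpleGraph (Fin n)) where
  p : Port G ≃ Port G
  adj : ∀ u v : Fin n, (∃ i : Fin (deg G u), (p ⟨u, i⟩).1 = v) ↔ G.Adj u v

/-- A consistent port numbering is an involution. -/
def PortNumbering.Consistent {n : ℕ} {G : SimpleGraph (Fin n)} (pn : PortNumbering G) : Prop :=
  ∀ q : Port G, pn.p (pn.p q) = q

/-- A distributed state machine for F(Δ), with stopping states Y. -/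
structure DSM (Y : Type) (Δ : ℕ) where
  Z : Type
  z₀ : Fin (Δ + 1) → Y ⊕ Z
  M : Type
  m₀ : M
  μ : Z → Fin Δ → M
  δ : Z → (Fin Δ → M) → Y ⊕ Z

namespace DSM

variable {Y : Type} {Δ : ℕ}

/-- μ extended to stopping states: a stopped node sends the dummy message. -/
def μ' (A : DSM Y Δ) : Y ⊕ A.Z → Fin Δ → A.M
  | Sum.inl _ => fun _ => A.m₀
  | Sum.inr z => A.μ z

/-- δ extended to stopping states: a stopped node no longer changes state. -/
def δ' (A : DSM Y Δ) : Y ⊕ A.Z → (Fin Δ → A.M) → Y ⊕ A.Z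
  | Sum.inl y, _ => Sum.inl y
  | Sum.inr z, m => A.δ z m

/-- Machines whose transition depends only on the multiset of received messages. -/
def InMultiset (A : DSM Y Δ) : Prop :=
  ∀ (z : A.Z) (a b : Fin Δ → A.M),
    (List.ofFn a : Multiset A.M) = (List.ofFn b : Multiset A.M) → A.δ z a = A.δ z b

/-- Machines whose transition depends only on the set of received messages. -/
def InSet (A : DSM Y Δ) : Prop :=
  ∀ (z : A.Z) (a b : Fin Δ → A.M), Set.range a = Set.range b → A.δ z a = A.δ z b

/-- Machines that send the same message to all ports. -/
def InBroadcast (A : DSM Y Δ) : Prop :=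
  ∀ (z : A.Z) (i j : Fin Δ), A.μ z i = A.μ z j

end DSM

/-- The execution of a machine in (G, p): the state of node u at time t. -/
noncomputable def exec {Y : Type} {Δ n : ℕ} (A : DSM Y Δ) (G : SimpleGraph (Fin n))
    (hG : ∀ v, deg G v ≤ Δ) (pn : PortNumbering G) : ℕ → Fin n → Y ⊕ A.Z
  | 0, u => A.z₀ ⟨deg G u, Nat.lt_succ_of_le (hG u)⟩
  | t + 1, u =>
      A.δ' (exec A G hG pn t u) fun k =>
        if h : (k : ℕ) < deg G u then
          A.μ' (exec A G hG pn t (pn.p.symm ⟨u, ⟨(k : ℕ), h⟩⟩).1)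
            ⟨((pn.p.symm ⟨u, ⟨(k : ℕ), h⟩⟩).2 : ℕ),
              lt_of_lt_of_le (pn.p.symm ⟨u, ⟨(k : ℕ), h⟩⟩).2.isLt (hG _)⟩
        else A.m₀

/-- A graph problem: for each graph, a set of admissible outputs. -/
abbrev GraphProblem (Y : Type) : Type :=
  ∀ n : ℕ, SimpleGraph (Fin n) → Set ((Fin n) → Y)

/-- A sequence of machines solves a problem in time T. -/
def SolvesInTime {Y : Type} (A : ∀ Δ : ℕ, DSM Y Δ) (P : GraphProblem Y)
    (T : ℕ → ℕ → ℕ) : Prop :=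
  ∀ (Δ n : ℕ) (G : SimpleGraph (Fin n)) (hG : ∀ v, deg G v ≤ Δ) (pn : PortNumbering G),
    ∃ S ∈ P n G, ∀ u, exec (A Δ) G hG pn (T Δ n) u = Sum.inl (S u)

/-- A sequence of machines solves a problem in time T assuming consistency. -/
def SolvesInTimeConsistent {Y : Type} (A : ∀ Δ : ℕ, DSM Y Δ) (P : GraphProblem Y)
    (T : ℕ → ℕ → ℕ) : Prop :=
  ∀ (Δ n : ℕ) (G : SimpleGraph (Fin n)) (hG : ∀ v, deg G v ≤ Δ) (pn : PortNumbering G),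
    pn.Consistent →
    ∃ S ∈ P n G, ∀ u, exec (A Δ) G hG pn (T Δ n) u = Sum.inl (S u)

/-- Problem class VV. -/
def VV {Y : Type} (P : GraphProblem Y) : Prop :=
  ∃ A : ∀ Δ : ℕ, DSM Y Δ, ∃ T, SolvesInTime A P T

/-- Problem class MV. -/
def MV {Y : Type} (P : GraphProblem Y) : Prop :=
  ∃ A : ∀ Δ : ℕ, DSM Y Δ, (∀ Δ, (A Δ).InMultiset) ∧ ∃ T, SolvesInTime A P T

/-- Problem class SV. -/
def SV {Y : Type} (P : GraphProblem Y) : Prop :=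
  ∃ A : ∀ Δ : ℕ, DSM Y Δ, (∀ Δ, (A Δ).InSet) ∧ ∃ T, SolvesInTime A P T

/-- Problem class VB. -/
def VB {Y : Type} (P : GraphProblem Y) : Prop :=
  ∃ A : ∀ Δ : ℕ, DSM Y Δ, (∀ Δ, (A Δ).InBroadcast) ∧ ∃ T, SolvesInTime A P T

/-- Problem class MB. -/
def MB {Y : Type} (P : GraphProblem Y) : Prop :=
  ∃ A : ∀ Δ : ℕ, DSM Y Δ, (∀ Δ, (A Δ).InMultiset ∧ (A Δ).InBroadcast) ∧ ∃ T, SolvesInTime A P T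

/-- Problem class SB. -/
def SB {Y : Type} (P : GraphProblem Y) : Prop :=
  ∃ A : ∀ Δ : ℕ, DSM Y Δ, (∀ Δ, (A Δ).InSet ∧ (A Δ).InBroadcast) ∧ ∃ T, SolvesInTime A P T

/-- Problem class VVc. -/
def VVc {Y : Type} (P : GraphProblem Y) : Prop :=
  ∃ A : ∀ Δ : ℕ, DSM Y Δ, ∃ T, SolvesInTimeConsistent A P T

/-- Constant-time problem class VV(1). -/
def VV1 {Y : Type} (P : GraphProblem Y) : Prop :=
  ∃ A : ∀ Δ : ℕ, DSM Y Δ, ∃ T' : ℕ → ℕ, SolvesInTime A P fun Δ _ => T' Δ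

/-- Constant-time problem class MV(1). -/
def MV1 {Y : Type} (P : GraphProblem Y) : Prop :=
  ∃ A : ∀ Δ : ℕ, DSM Y Δ, (∀ Δ, (A Δ).InMultiset) ∧
    ∃ T' : ℕ → ℕ, SolvesInTime A P fun Δ _ => T' Δ

/-- Constant-time problem class SV(1). -/
def SV1 {Y : Type} (P : GraphProblem Y) : Prop :=
  ∃ A : ∀ Δ : ℕ, DSM Y Δ, (∀ Δ, (A Δ).InSet) ∧
    ∃ T' : ℕ → ℕ, SolvesInTime A P fun Δ _ => T' Δ

/-- Constant-time problem class VB(1). -/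
def VB1 {Y : Type} (P : GraphProblem Y) : Prop :=
  ∃ A : ∀ Δ : ℕ, DSM Y Δ, (∀ Δ, (A Δ).InBroadcast) ∧
    ∃ T' : ℕ → ℕ, SolvesInTime A P fun Δ _ => T' Δ

/-- Constant-time problem class MB(1). -/
def MB1 {Y : Type} (P : GraphProblem Y) : Prop :=
  ∃ A : ∀ Δ : ℕ, DSM Y Δ, (∀ Δ, (A Δ).InMultiset ∧ (A Δ).InBroadcast) ∧
    ∃ T' : ℕ → ℕ, SolvesInTime A P fun Δ _ => T' Δ

/-- Constant-time problem class SB(1). -/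
def SB1 {Y : Type} (P : GraphProblem Y) : Prop :=
  ∃ A : ∀ Δ : ℕ, DSM Y Δ, (∀ Δ, (A Δ).InSet ∧ (A Δ).InBroadcast) ∧
    ∃ T' : ℕ → ℕ, SolvesInTime A P fun Δ _ => T' Δ

/-- Constant-time problem class VVc(1). -/
def VVc1 {Y : Type} (P : GraphProblem Y) : Prop :=
  ∃ A : ∀ Δ : ℕ, DSM Y Δ, ∃ T' : ℕ → ℕ, SolvesInTimeConsistent A P fun Δ _ => T' Δ

end Weak
namespace Weak
/-- G has a 1-factor (perfect matching). -/
def HasOneFactor {n : ℕ} (G : SimpleGraph (Fin n)) : Prop :=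
  ∃ F : SimpleGraph (Fin n), F ≤ G ∧ ∀ v : Fin n, ∃! u : Fin n, F.Adj v u

/-- G is in the class 𝒢: connected, regular of odd degree, and without a 1-factor. -/
def InCalG {n : ℕ} (G : SimpleGraph (Fin n)) : Prop :=
  G.Connected ∧ (∃ k, Odd k ∧ ∀ v, deg G v = k) ∧ ¬ HasOneFactor G

/-- The symmetry-breaking problem: on graphs in 𝒢 the output must be non-constant. -/
def nonConstOnCalG : GraphProblem Bool := fun n G =>
  { S | InCalG G → ∃ u v : Fin n, S u ≠ S v }

/-! ### Symmetric port numberings -/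

section Symmetric

variable {n k : ℕ} {G : SimpleGraph (Fin n)}

/-- In a `k`-regular graph, ports are pairs of a node and an element of `Fin k`. -/
noncomputable def portEquiv (hk : ∀ v, deg G v = k) : Port G ≃ Fin n × Fin k :=
  (Equiv.sigmaCongrRight fun v => finCongr (hk v)).trans (Equiv.sigmaEquivProd _ _)

/-- Permutations `π i` whose union is the edge relation give a port numbering that maps
port `i` of `v` to port `i` of `π i v`. -/
noncomputable def permPortNumbering (hk : ∀ v, deg G v = k) (π : Fin k → Equiv.Perm (Fin n))
    (hπ : ∀ u v, (∃ i, π i u = v) ↔ G.Adj u v) : PortNumbering G where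
  p := (portEquiv hk).trans <|
    (((Equiv.prodComm _ _).trans (Equiv.prodShear (Equiv.refl _) π)).trans
      (Equiv.prodComm _ _)).trans (portEquiv hk).symm
  adj u v := by
    rw [← hπ]
    constructor
    · rintro ⟨i, rfl⟩
      exact ⟨finCongr (hk u) i, rfl⟩
    · rintro ⟨i, rfl⟩
      exact ⟨finCongr (hk u).symm i, rfl⟩

lemma permPortNumbering_symm_snd (hk : ∀ v, deg G v = k) (π : Fin k → Equiv.Perm (Fin n))
    (hπ : ∀ u v, (∃ i, π i u = v) ↔ G.Adj u v) (q : Port G) :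
    (((permPortNumbering hk π hπ).p.symm q).2 : ℕ) = q.2 := rfl

/-- Under a symmetric port numbering all nodes are in the same state forever. -/
lemma exec_permPortNumbering {Y : Type} {Δ : ℕ} (A : DSM Y Δ) (hG : ∀ v, deg G v ≤ Δ)
    (hk : ∀ v, deg G v = k) (π : Fin k → Equiv.Perm (Fin n))
    (hπ : ∀ u v, (∃ i, π i u = v) ↔ G.Adj u v) (t : ℕ) (u v : Fin n) :
    exec A G hG (permPortNumbering hk π hπ) t u =
      exec A G hG (permPortNumbering hk π hπ) t v := by
  induction t generalizing u v with
  | zero => simp only [exec, hk]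
  | succ t ih =>
    simp only [exec, permPortNumbering_symm_snd]
    rw [ih u v]
    congr 1
    funext j
    by_cases h : (j : ℕ) < k
    · rw [dif_pos (by rwa [hk]), dif_pos (by rwa [hk])]
      exact congrArg (fun s => A.μ' s j) (ih _ _)
    · rw [dif_neg (by rwa [hk]), dif_neg (by rwa [hk])]

lemma not_VV_of_perm (hG : InCalG G) (hk : ∀ v, deg G v = k) (π : Fin k → Equiv.Perm (Fin n))
    (hπ : ∀ u v, (∃ i, π i u = v) ↔ G.Adj u v) : ¬ VV nonConstOnCalG := by
  rintro ⟨A, T, h⟩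
  obtain ⟨S, hS, hex⟩ := h k n G (fun v => (hk v).le) (permPortNumbering hk π hπ)
  obtain ⟨u, v, huv⟩ := hS hG
  refine huv (Sum.inl_injective (β := (A k).Z) ?_)
  rw [← hex u, ← hex v]
  exact exec_permPortNumbering ..

end Symmetric

/-! ### A connected cubic graph without a 1-factor -/

/-- Three permutations of `Fin 16` whose union is the edge relation of `cubicGraph`. -/
def cubicPerm : Fin 3 → Equiv.Perm (Fin 16) := ![
  ⟨![11, 2, 5, 1, 3, 4, 8, 10, 6, 7, 9, 0, 15, 14, 13, 12],
    ![11, 3, 1, 4, 5, 2, 8, 9, 6, 10, 7, 0, 15, 14, 13, 12], by decide, by decide⟩,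
  ⟨![1, 0, 4, 5, 2, 3, 7, 6, 9, 10, 8, 12, 14, 11, 15, 13],
    ![1, 0, 4, 5, 2, 3, 7, 6, 10, 8, 9, 13, 11, 15, 12, 14], by decide, by decide⟩,
  ⟨![6, 3, 1, 4, 5, 2, 0, 9, 10, 8, 7, 13, 11, 15, 12, 14],
    ![6, 2, 5, 1, 3, 4, 0, 10, 9, 7, 8, 12, 14, 11, 15, 13], by decide, by decide⟩]

/-- The cubic graph on 16 nodes in which node `0` is joined to three copies of `K₄` with a
subdivided edge, through the subdividing nodes `1`, `6` and `11`. -/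
def cubicGraph : SimpleGraph (Fin 16) where
  Adj u v := ∃ i, cubicPerm i u = v
  symm := ⟨by decide⟩
  loopless := ⟨by decide⟩

instance : DecidableRel cubicGraph.Adj := fun u v =>
  inferInstanceAs (Decidable (∃ i, cubicPerm i u = v))

lemma deg_cubicGraph (v : Fin 16) : deg cubicGraph v = 3 := by
  rw [deg, Nat.card_eq_fintype_card]
  revert v
  decide

lemma connected_cubicGraph : cubicGraph.Connected := by
  have parent : ∀ v : Fin 16, v ≠ 0 → ∃ w < v, cubicGraph.Adj v w := by decide
  have reach : ∀ v : Fin 16, cubicGraph.Reachable v 0 := by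
    intro v
    induction v using WellFoundedLT.induction with
    | ind v ih =>
      by_cases hv : v = 0
      · rw [hv]
      · obtain ⟨w, hw, hvw⟩ := parent v hv
        exact hvw.reachable.trans (ih w hw)
  exact { preconnected := fun u v => (reach u).trans (reach v).symm }

/-- In a perfect matching, a copy of `K₄` with an edge subdivided by `a` has odd order, so `a`
is matched to its third neighbor `o`. -/
lemma matched_out_of_gadget {α : Type*} {f : α → α} (hf : Function.Involutive f)
    {o a b c d e : α} (hne : [a, b, c, d, e].Nodup)
    (ha : f a = o ∨ f a = b ∨ f a = c) (hb : f b = a ∨ f b = d ∨ f b = e)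
    (hc : f c = a ∨ f c = d ∨ f c = e) (hd : f d = b ∨ f d = c ∨ f d = e)
    (he : f e = b ∨ f e = c ∨ f e = d) : f a = o := by
  have h1 := hf a
  have h2 := hf b
  have h3 := hf c
  have h4 := hf d
  have h5 := hf e
  simp only [List.nodup_cons, List.mem_cons, List.not_mem_nil, not_or] at hne
  grind

lemma not_hasOneFactor_cubicGraph : ¬ HasOneFactor cubicGraph := by
  rintro ⟨F, hFG, hF⟩
  choose f hadj huniq using hF
  have hf : Function.Involutive f := fun v => (huniq (f v) v (hadj v).symm).symm
  have nbr : ∀ {v x y z : Fin 16}, (∀ w, cubicGraph.Adj v w → w = x ∨ w = y ∨ w = z) →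
      f v = x ∨ f v = y ∨ f v = z := fun {v _ _ _} h => h _ (hFG (hadj v))
  have h1 : f 1 = 0 := matched_out_of_gadget hf (b := 2) (c := 3) (d := 4) (e := 5)
    (by decide) (nbr (by decide)) (nbr (by decide)) (nbr (by decide)) (nbr (by decide))
    (nbr (by decide))
  have h6 : f 6 = 0 := matched_out_of_gadget hf (b := 7) (c := 8) (d := 9) (e := 10)
    (by decide) (nbr (by decide)) (nbr (by decide)) (nbr (by decide)) (nbr (by decide))
    (nbr (by decide))
  exact absurd (hf.injective (h1.trans h6.symm)) (by decide)

lemma not_VV_nonConstOnCalG : ¬ VV nonConstOnCalG :=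
  not_VV_of_perm
    ⟨connected_cubicGraph, ⟨3, by decide, deg_cubicGraph⟩, not_hasOneFactor_cubicGraph⟩
    deg_cubicGraph cubicPerm fun _ _ => Iff.rfl

/-! ### Comparing local types under a consistent port numbering -/

/-- In the first round each node sends its port numbers and encodes what it receives as its
local type; in the second round it compares its local type with those of its neighbors. -/
def typeMachine (Δ : ℕ) : DSM Bool Δ where
  Z := Option ℕ
  z₀ _ := Sum.inr none
  M := ℕ
  m₀ := 0
  μ
    | none, i => i + 1
    | some c, _ => c
  δ
    | none, a => Sum.inr (some (Encodable.encode a))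
    | some c, a => Sum.inl (decide (∀ i, a i ≤ c))

section Consistent

variable {n Δ : ℕ} {G : SimpleGraph (Fin n)}

/-- The local type of a node: the port numbers at the far ends of its ports, encoded. -/
noncomputable def localType (Δ : ℕ) (pn : PortNumbering G) (u : Fin n) : ℕ :=
  Encodable.encode fun j : Fin Δ =>
    if h : (j : ℕ) < deg G u then ((pn.p.symm ⟨u, ⟨j, h⟩⟩).2 : ℕ) + 1 else 0

lemma exec_typeMachine_two (hG : ∀ v, deg G v ≤ Δ) (pn : PortNumbering G) (u : Fin n) :
    exec (typeMachine Δ) G hG pn 2 u = Sum.inl (decide (∀ j : Fin Δ,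
      (if h : (j : ℕ) < deg G u then localType Δ pn (pn.p.symm ⟨u, ⟨j, h⟩⟩).1 else 0) ≤
        localType Δ pn u)) := rfl

/-- Nodes of the same degree and local type have equal port numbers at the far ends. -/
lemma snd_eq_of_localType_eq (hG : ∀ v, deg G v ≤ Δ) (pn : PortNumbering G) {u v : Fin n}
    (huv : localType Δ pn u = localType Δ pn v) {i : ℕ} (hu : i < deg G u) (hv : i < deg G v) :
    ((pn.p.symm ⟨u, ⟨i, hu⟩⟩).2 : ℕ) = (pn.p.symm ⟨v, ⟨i, hv⟩⟩).2 := by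
  have h := congrFun (Encodable.encode_injective huv) ⟨i, hu.trans_le (hG u)⟩
  simpa [hu, hv] using h

lemma PortNumbering.Consistent.symm_eq {pn : PortNumbering G} (hc : pn.Consistent) (q : Port G) :
    pn.p.symm q = pn.p q :=
  pn.p.symm_apply_eq.mpr (hc q).symm

/-- Edges joining port `i` to port `i` at every node form a 1-factor. -/
lemma hasOneFactor_of_port_fixed {pn : PortNumbering G} (hc : pn.Consistent) {i : ℕ}
    (hi : ∀ v, i < deg G v) (hfix : ∀ v, ((pn.p ⟨v, ⟨i, hi v⟩⟩).2 : ℕ) = i) :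
    HasOneFactor G := by
  have hp : ∀ v, pn.p ⟨v, ⟨i, hi v⟩⟩ =
      ⟨(pn.p ⟨v, ⟨i, hi v⟩⟩).1, ⟨i, hi _⟩⟩ := fun v =>
    Sigma.ext rfl (heq_of_eq (Fin.ext (hfix v)))
  have hadj : ∀ v, G.Adj v (pn.p ⟨v, ⟨i, hi v⟩⟩).1 := fun v => (pn.adj _ _).mp ⟨_, rfl⟩
  refine ⟨⟨fun u v => (pn.p ⟨u, ⟨i, hi u⟩⟩).1 = v, ⟨?_⟩, ⟨?_⟩⟩, ?_, ?_⟩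
  · rintro u v rfl
    rw [← hp, hc]
  · exact fun u hu => (hadj u).ne hu.symm
  · rintro u v rfl
    exact hadj u
  · exact fun v => ⟨_, rfl, fun _ h => Eq.symm h⟩

lemma exists_fixed_of_involutive_of_odd {k : ℕ} (hk : Odd k) {t : Fin k → Fin k}
    (ht : Function.Involutive t) : ∃ i, t i = i :=
  Equiv.Perm.exists_fixed_point_of_prime (p := 2) (n := 1) (σ := ht.toPerm)
    (by rw [Fintype.card_fin]; exact hk.not_two_dvd_nat)
    (by ext i; simp [pow_two, ht i])

/-- If all local types agree in a regular graph of odd degree, there is a 1-factor. -/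
lemma hasOneFactor_of_localType_eq [Nonempty (Fin n)] (hG : ∀ v, deg G v ≤ Δ)
    {pn : PortNumbering G} (hc : pn.Consistent) {k : ℕ} (hk : Odd k) (hdeg : ∀ v, deg G v = k)
    (heq : ∀ u v, localType Δ pn u = localType Δ pn v) : HasOneFactor G := by
  obtain ⟨w⟩ := ‹Nonempty (Fin n)›
  let t : Fin k → Fin k := fun i => finCongr (hdeg _) (pn.p ⟨w, finCongr (hdeg w).symm i⟩).2
  have ht : ∀ v i, ((pn.p ⟨v, finCongr (hdeg v).symm i⟩).2 : ℕ) = t i := by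
    intro v i
    rw [← hc.symm_eq]
    refine (snd_eq_of_localType_eq hG pn (heq v w) _ (i.isLt.trans_eq (hdeg w).symm)).trans ?_
    rw [hc.symm_eq]
    rfl
  have hinv : Function.Involutive t := by
    intro i
    have h : (⟨(pn.p ⟨w, finCongr (hdeg w).symm i⟩).1, finCongr (hdeg _).symm (t i)⟩ : Port G)
      = pn.p ⟨w, finCongr (hdeg w).symm i⟩ := rfl
    ext
    rw [← ht (pn.p ⟨w, finCongr (hdeg w).symm i⟩).1, h, hc]
    rfl
  obtain ⟨i, hi⟩ := exists_fixed_of_involutive_of_odd hk hinv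
  exact hasOneFactor_of_port_fixed hc (fun v => i.isLt.trans_eq (hdeg v).symm)
    fun v => (ht v i).trans (congrArg Fin.val hi)

lemma localType_le_of_adj (hG : ∀ v, deg G v ≤ Δ) {pn : PortNumbering G} (hc : pn.Consistent)
    {u v : Fin n} (huv : G.Adj u v)
    (hu : ∀ j : Fin Δ, (if h : (j : ℕ) < deg G u then
      localType Δ pn (pn.p.symm ⟨u, ⟨j, h⟩⟩).1 else 0) ≤ localType Δ pn u) :
    localType Δ pn v ≤ localType Δ pn u := by
  obtain ⟨i, rfl⟩ := (pn.adj u v).mpr huv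
  have h := hu ⟨i, i.isLt.trans_le (hG u)⟩
  rwa [dif_pos i.isLt, hc.symm_eq] at h

end Consistent

lemma VVc1_nonConstOnCalG : VVc1 nonConstOnCalG := by
  refine ⟨typeMachine, fun _ => 2, fun Δ n G hG pn hc =>
    ⟨_, ?_, exec_typeMachine_two hG pn⟩⟩
  rintro ⟨hconn, ⟨k, hk, hdeg⟩, hno⟩
  by_contra! hconst
  have := hconn.nonempty
  obtain ⟨m, hm⟩ := Finite.exists_max (localType Δ pn)
  have hmax : ∀ u v, G.Adj u v → localType Δ pn v ≤ localType Δ pn u := by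
    intro u v huv
    refine localType_le_of_adj hG hc huv (of_decide_eq_true ((hconst u m).trans ?_))
    refine decide_eq_true fun j => ?_
    split_ifs
    exacts [hm _, Nat.zero_le _]
  refine hno (hasOneFactor_of_localType_eq hG hc hk hdeg fun u v => ?_)
  obtain ⟨p⟩ := hconn.preconnected u v
  induction p with
  | nil => rfl
  | cons h _ ih => exact ((hmax _ _ h.symm).antisymm (hmax _ _ h)).trans ih

/-- The problem is in VVc(1) but not in VV. -/
theorem nonConstOnCalG_VVc1_not_VV : VVc1 nonConstOnCalG ∧ ¬ VV nonConstOnCalG :=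
  ⟨VVc1_nonConstOnCalG, not_VV_nonConstOnCalG⟩
end Weak
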